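/- (Monotonicity of the chord slope and Lax inequalities for backward shocks.) Let ρ > 0, T_l < 0, and let T₂ > 0 be the unique solution of ε(T₂) − ε(T_l) = ε'(T₂)(T₂ − T_l) with T₂ > T_l. Define the chord slope m(T) = (ε(T) − ε(T_l))/(T − T_l) for T ∈ (T_l, T₂]. Then m is strictly decreasing on (T_l, T₂], m(T) → ε'(T_l) as T → T_l⁺, m(T₂) = ε'(T₂), and ε'(T) < m(T) < ε'(T_l) for every T ∈ (T_l, T₂). Consequently, for every T ∈ (T_l, T₂), the backward shock speed s₁ = −1/√(ρ·m(T)) satisfies the Lax inequalities λ₁(T_l) > s₁ > λ₁(T), where λ₁(x) = −1/√(ρ ε'(x)). -/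

import Mathlib

/-- The strain–stress function `ε(T) = βT + α(1 + (γ/2)T²)ⁿ T`,
where the power with real exponent is `Real.rpow`. -/
noncomputable def eps (α β γ n : ℝ) : ℝ → ℝ :=
  fun T => β * T + α * (1 + γ / 2 * T ^ 2) ^ n * T

/-- The chord slope `m(T) = (ε(T) − ε(T_l))/(T − T_l)`. -/
noncomputable def chordSlope (α β γ n Tl : ℝ) : ℝ → ℝ :=
  fun T => (eps α β γ n T - eps α β γ n Tl) / (T - Tl)

open Set Filter Topology

/-- The derivative of the strain–stress function, in closed form. -/
noncomputable def epsDeriv (α β γ n T : ℝ) : ℝ :=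
  β + α * ((1 + γ / 2 * T ^ 2) ^ n * (1 + 2 * n - 2 * n / (1 + γ / 2 * T ^ 2)))

lemma hasDerivAt_eps {γ : ℝ} (α β n : ℝ) (hγ : 0 < γ) (T : ℝ) :
    HasDerivAt (eps α β γ n) (epsDeriv α β γ n T) T := by
  have hu : 0 < 1 + γ / 2 * T ^ 2 := by positivity
  have h₁ : HasDerivAt (fun x : ℝ => 1 + γ / 2 * x ^ 2) (γ / 2 * (2 * T)) T := by
    simpa using ((hasDerivAt_pow 2 T).const_mul (γ / 2)).const_add 1
  have h₂ := h₁.rpow_const (p := n) (Or.inl hu.ne')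
  have h₃ := ((hasDerivAt_id T).const_mul β).add ((h₂.const_mul α).mul (hasDerivAt_id T))
  refine h₃.congr_deriv ?_
  rw [epsDeriv, Real.rpow_sub_one hu.ne']
  simp only [id]
  field_simp
  ring

lemma deriv_eps {γ : ℝ} (α β n : ℝ) (hγ : 0 < γ) :
    deriv (eps α β γ n) = epsDeriv α β γ n :=
  funext fun T => (hasDerivAt_eps α β n hγ T).deriv

lemma epsDeriv_lt_of_sq_lt {α γ n x y : ℝ} (β : ℝ) (hα : 0 < α) (hγ : 0 < γ) (hn : 0 < n)
    (h : x ^ 2 < y ^ 2) : epsDeriv α β γ n x < epsDeriv α β γ n y := by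
  have hx : 1 ≤ 1 + γ / 2 * x ^ 2 := by
    have : 0 ≤ γ / 2 * x ^ 2 := by positivity
    linarith
  have hxy : 1 + γ / 2 * x ^ 2 < 1 + γ / 2 * y ^ 2 := by gcongr
  unfold epsDeriv
  generalize 1 + γ / 2 * x ^ 2 = u at *
  generalize 1 + γ / 2 * y ^ 2 = v at *
  have hu : 0 < u := by linarith
  have hpow : u ^ n < v ^ n := Real.rpow_lt_rpow hu.le hxy hn
  have hdiv : 2 * n / v < 2 * n / u := by gcongr
  have hle : 2 * n / u ≤ 2 * n := div_le_self (by positivity) hx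
  have := mul_lt_mul'' hpow (show 1 + 2 * n - 2 * n / u < 1 + 2 * n - 2 * n / v by linarith)
    (by positivity) (by linarith)
  gcongr

lemma epsDeriv_pos {α β γ n : ℝ} (hα : 0 < α) (hγ : 0 < γ) (hn : 0 < n) (hαβ : 0 < α + β)
    (x : ℝ) : 0 < epsDeriv α β γ n x := by
  have h₀ : epsDeriv α β γ n 0 = α + β := by simp [epsDeriv, add_comm]
  rcases eq_or_ne x 0 with rfl | hx
  · rwa [h₀]
  · have := epsDeriv_lt_of_sq_lt β hα hγ hn (x := 0) (y := x)
      (by rw [zero_pow two_ne_zero]; positivity)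
    linarith

lemma exists_eps_sub_eq {γ a b : ℝ} (α β n : ℝ) (hγ : 0 < γ) (hab : a < b) :
    ∃ c ∈ Ioo a b, eps α β γ n b - eps α β γ n a = epsDeriv α β γ n c * (b - a) := by
  obtain ⟨c, hc, h⟩ := exists_hasDerivAt_eq_slope (eps α β γ n) (epsDeriv α β γ n) hab
    (fun x _ => (hasDerivAt_eps α β n hγ x).continuousAt.continuousWithinAt)
    (fun x _ => hasDerivAt_eps α β n hγ x)
  refine ⟨c, hc, ?_⟩
  rw [h, div_mul_cancel₀ _ (sub_pos.2 hab).ne']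

lemma chordSlope_mem_Ioo_of_nonpos {α γ n Tl T : ℝ} (β : ℝ) (hα : 0 < α) (hγ : 0 < γ)
    (hn : 0 < n) (hT : Tl < T) (hT₀ : T ≤ 0) :
    chordSlope α β γ n Tl T ∈ Ioo (epsDeriv α β γ n T) (epsDeriv α β γ n Tl) := by
  obtain ⟨c, ⟨hc₁, hc₂⟩, h⟩ := exists_eps_sub_eq α β n hγ hT
  have hm : chordSlope α β γ n Tl T = epsDeriv α β γ n c := by
    rw [chordSlope, h, mul_div_cancel_right₀ _ (sub_pos.2 hT).ne']
  rw [hm]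
  exact ⟨epsDeriv_lt_of_sq_lt β hα hγ hn (by nlinarith),
    epsDeriv_lt_of_sq_lt β hα hγ hn (by nlinarith)⟩

lemma epsDeriv_lt_chordSlope {α γ n Tl T₂ T : ℝ} (β : ℝ) (hα : 0 < α) (hγ : 0 < γ) (hn : 0 < n)
    (htan : eps α β γ n T₂ - eps α β γ n Tl = epsDeriv α β γ n T₂ * (T₂ - Tl))
    (hT : T ∈ Ioo Tl T₂) : epsDeriv α β γ n T < chordSlope α β γ n Tl T := by
  obtain ⟨hT₁, hT₂⟩ := hT
  rcases le_or_gt T 0 with hT₀ | hT₀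
  · exact (chordSlope_mem_Ioo_of_nonpos β hα hγ hn hT₁ hT₀).1
  · obtain ⟨c, ⟨hc₁, hc₂⟩, h⟩ := exists_eps_sub_eq α β n hγ hT₂
    have hc := epsDeriv_lt_of_sq_lt β hα hγ hn (x := c) (y := T₂) (by nlinarith)
    have hlt := epsDeriv_lt_of_sq_lt β hα hγ hn (x := T) (y := T₂) (by nlinarith)
    refine hlt.trans ?_
    rw [chordSlope, lt_div_iff₀ (sub_pos.2 hT₁)]
    nlinarith [mul_lt_mul_of_pos_right hc (sub_pos.2 hT₂)]

lemma hasDerivAt_chordSlope {γ Tl T : ℝ} (α β n : ℝ) (hγ : 0 < γ) (hT : Tl < T) :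
    HasDerivAt (chordSlope α β γ n Tl)
      ((epsDeriv α β γ n T - chordSlope α β γ n Tl T) / (T - Tl)) T := by
  have hne : T - Tl ≠ 0 := (sub_pos.2 hT).ne'
  refine (((hasDerivAt_eps α β n hγ T).sub_const (eps α β γ n Tl)).div
    ((hasDerivAt_id T).sub_const Tl) hne).congr_deriv ?_
  simp only [chordSlope, id]
  field_simp

lemma strictAntiOn_chordSlope {α γ n Tl T₂ : ℝ} (β : ℝ) (hα : 0 < α) (hγ : 0 < γ) (hn : 0 < n)
    (htan : eps α β γ n T₂ - eps α β γ n Tl = epsDeriv α β γ n T₂ * (T₂ - Tl)) :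
    StrictAntiOn (chordSlope α β γ n Tl) (Ioc Tl T₂) := by
  refine strictAntiOn_of_deriv_neg (convex_Ioc _ _)
    (fun x hx => (hasDerivAt_chordSlope α β n hγ hx.1).continuousAt.continuousWithinAt)
    fun x hx => ?_
  rw [interior_Ioc] at hx
  rw [(hasDerivAt_chordSlope α β n hγ hx.1).deriv]
  exact div_neg_of_neg_of_pos (sub_neg.2 (epsDeriv_lt_chordSlope β hα hγ hn htan hx))
    (sub_pos.2 hx.1)

lemma tendsto_chordSlope {γ : ℝ} (α β n Tl : ℝ) (hγ : 0 < γ) :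
    Tendsto (chordSlope α β γ n Tl) (𝓝[>] Tl) (𝓝 (epsDeriv α β γ n Tl)) := by
  have h := (hasDerivAt_iff_tendsto_slope.1 (hasDerivAt_eps α β n hγ Tl)).mono_left
    (nhdsWithin_mono Tl fun x (hx : Tl < x) => hx.ne')
  refine h.congr fun x => ?_
  rw [slope_def_field, chordSlope]

lemma neg_one_div_sqrt_mul_lt {ρ a b : ℝ} (hρ : 0 < ρ) (ha : 0 < a) (hab : a < b) :
    -1 / √(ρ * a) < -1 / √(ρ * b) := by
  rw [neg_div, neg_div, neg_lt_neg_iff]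
  have : 0 < √(ρ * a) := Real.sqrt_pos.2 (mul_pos hρ ha)
  have : √(ρ * a) < √(ρ * b) :=
    Real.sqrt_lt_sqrt (mul_pos hρ ha).le (mul_lt_mul_of_pos_left hab hρ)
  gcongr


/-- Monotonicity of the chord slope and Lax inequalities for backward shocks:
for `T_l < 0` and `T₂ > 0` the tangency point, the chord slope `m` is strictly
decreasing on `(T_l, T₂]`, `m(T) → ε'(T_l)` as `T → T_l⁺`, `m(T₂) = ε'(T₂)`, and
`ε'(T) < m(T) < ε'(T_l)` on `(T_l, T₂)`; hence the backward shock speed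
`s₁ = −1/√(ρ m(T))` satisfies `λ₁(T_l) > s₁ > λ₁(T)`. -/
theorem stmt_12 (α β γ n ρ Tl T₂ : ℝ) (hα : 0 < α) (hβ : β < 0) (hγ : 0 < γ)
    (hn : 0 < n) (hαβ : 0 < α + β) (hρ : 0 < ρ) (hTl : Tl < 0)
    (hT₂pos : 0 < T₂) (hT₂gt : Tl < T₂)
    (htan : eps α β γ n T₂ - eps α β γ n Tl = deriv (eps α β γ n) T₂ * (T₂ - Tl)) :
    StrictAntiOn (chordSlope α β γ n Tl) (Set.Ioc Tl T₂) ∧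
    Filter.Tendsto (chordSlope α β γ n Tl) (nhdsWithin Tl (Set.Ioi Tl))
      (nhds (deriv (eps α β γ n) Tl)) ∧
    chordSlope α β γ n Tl T₂ = deriv (eps α β γ n) T₂ ∧
    (∀ T ∈ Set.Ioo Tl T₂,
      deriv (eps α β γ n) T < chordSlope α β γ n Tl T ∧
        chordSlope α β γ n Tl T < deriv (eps α β γ n) Tl) ∧
    (∀ T ∈ Set.Ioo Tl T₂,
      -1 / Real.sqrt (ρ * (chordSlope α β γ n Tl T)) <
          -1 / Real.sqrt (ρ * deriv (eps α β γ n) Tl) ∧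
        -1 / Real.sqrt (ρ * deriv (eps α β γ n) T) <
          -1 / Real.sqrt (ρ * (chordSlope α β γ n Tl T))) := by
  rw [deriv_eps α β n hγ] at htan ⊢
  have hanti := strictAntiOn_chordSlope β hα hγ hn htan
  have hlower : ∀ T ∈ Ioo Tl T₂, epsDeriv α β γ n T < chordSlope α β γ n Tl T :=
    fun T hT => epsDeriv_lt_chordSlope β hα hγ hn htan hT
  have hupper : ∀ T ∈ Ioo Tl T₂, chordSlope α β γ n Tl T < epsDeriv α β γ n Tl := by
    intro T hT
    rcases le_or_gt T 0 with hT₀ | hT₀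
    · exact (chordSlope_mem_Ioo_of_nonpos β hα hγ hn hT.1 hT₀).2
    · exact (hanti ⟨hTl, hT₂pos.le⟩ ⟨hT.1, hT.2.le⟩ hT₀).trans
        (chordSlope_mem_Ioo_of_nonpos β hα hγ hn hTl le_rfl).2
  have hpos := epsDeriv_pos hα hγ hn hαβ
  refine ⟨hanti, tendsto_chordSlope α β n Tl hγ, ?_, fun T hT => ⟨hlower T hT, hupper T hT⟩,
    fun T hT => ⟨?_, ?_⟩⟩
  · rw [chordSlope, htan, mul_div_cancel_right₀ _ (sub_pos.2 hT₂gt).ne']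
  · exact neg_one_div_sqrt_mul_lt hρ ((hpos T).trans (hlower T hT)) (hupper T hT)
  · exact neg_one_div_sqrt_mul_lt hρ (hpos T) (hlower T hT)
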